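/- Contraction of the diatomic Bellman operator: let α ∈ (0,1) and π ∈ Π. For all Q, Q̃ : X×A → ℝ², ‖T^π_α Q − T^π_α Q̃‖_∞ ≤ γ ‖Q − Q̃‖_∞. -/

import Mathlib

open MeasureTheory ProbabilityTheory Finset Set

noncomputable section

/-- Quantile (generalized inverse distribution) function of a measure on `ℝ`. -/
def quantileFn (ν : Measure ℝ) (τ : ℝ) : ℝ :=
  sInf {z : ℝ | τ ≤ cdf ν z}

/-- Left average value-at-risk at level `α`. -/
def avarLeft (α : ℝ) (ν : Measure ℝ) : ℝ :=
  (1 / α) * ∫ τ in (0:ℝ)..α, quantileFn ν τ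

/-- Right average value-at-risk at level `1 - α`. -/
def avarRight (α : ℝ) (ν : Measure ℝ) : ℝ :=
  (1 / (1 - α)) * ∫ τ in α..(1:ℝ), quantileFn ν τ

/-- A measure on `ℝ` with bounded support. -/
def HasBoundedSupport (ν : Measure ℝ) : Prop :=
  ∃ a b : ℝ, ν (Set.Icc a b)ᶜ = 0

/-- Finite Markov decision process with fixed state and action spaces. -/
structure MDP (X A : Type) [Fintype X] [Fintype A] where
  P : X → A → X → ℝ
  r : X → A → X → ℝ
  γ : ℝ
  P_nonneg : ∀ x a x', 0 ≤ P x a x'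
  P_sum_one : ∀ x a, ∑ x', P x a x' = 1
  γ_nonneg : 0 ≤ γ
  γ_lt_one : γ < 1

variable {X A : Type} [Fintype X] [Fintype A]

/-- A stationary Markovian policy. -/
def IsPolicy (π : X → A → ℝ) : Prop :=
  (∀ x a, 0 ≤ π x a) ∧ ∀ x, ∑ a, π x a = 1

/-- The discrete measure `(T^π D_{α,Q})^{(x,a)}`. -/
def diatomicMeasure (M : MDP X A) (α : ℝ) (π : X → A → ℝ)
    (Q : X → A → ℝ × ℝ) (x : X) (a : A) : Measure ℝ :=
  ∑ x' : X, ∑ a' : A, ENNReal.ofReal (M.P x a x' * π x' a') •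
    (ENNReal.ofReal α • Measure.dirac (M.r x a x' + M.γ * (Q x' a').1)
      + ENNReal.ofReal (1 - α) • Measure.dirac (M.r x a x' + M.γ * (Q x' a').2))

/-- The diatomic Bellman operator `T^π_α`. -/
def diatomicT (M : MDP X A) (α : ℝ) (π : X → A → ℝ)
    (Q : X → A → ℝ × ℝ) : X → A → ℝ × ℝ :=
  fun x a => (avarLeft α (diatomicMeasure M α π Q x a),
              avarRight α (diatomicMeasure M α π Q x a))

/-- Supremum norm of a double Q-function. -/
def pairSupNorm [Nonempty X] [Nonempty A] (Q : X → A → ℝ × ℝ) : ℝ :=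
  ⨆ p : X × A, max |(Q p.1 p.2).1| |(Q p.1 p.2).2|

lemma one_le_cdf_of_compl_Icc {ν : Measure ℝ} [IsProbabilityMeasure ν] {a b : ℝ}
    (h : ν (Set.Icc a b)ᶜ = 0) : 1 ≤ cdf ν b := by
  have h1 : ν (Set.Icc a b) = 1 := (prob_compl_eq_zero_iff measurableSet_Icc).1 h
  have h2 : ν (Set.Iic b) = 1 :=
    le_antisymm prob_le_one (h1 ▸ measure_mono Set.Icc_subset_Iic_self)
  rw [cdf_eq_real, measureReal_def, h2, ENNReal.toReal_one]

lemma cdf_eq_zero_of_compl_Icc {ν : Measure ℝ} [IsProbabilityMeasure ν] {a b z : ℝ}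
    (h : ν (Set.Icc a b)ᶜ = 0) (hz : z < a) : cdf ν z = 0 := by
  have h2 : ν (Set.Iic z) = 0 :=
    measure_mono_null (t := (Set.Icc a b)ᶜ) (fun _ hy hy' => not_le.2 hz (hy'.1.trans hy)) h
  rw [cdf_eq_real, measureReal_def, h2, ENNReal.toReal_zero]

lemma le_of_le_cdf {ν : Measure ℝ} [IsProbabilityMeasure ν] {a b τ z : ℝ}
    (h : ν (Set.Icc a b)ᶜ = 0) (hτ : 0 < τ) (hz : τ ≤ cdf ν z) : a ≤ z := by
  by_contra! hlt
  rw [cdf_eq_zero_of_compl_Icc h hlt] at hz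
  exact absurd hz (not_le.2 hτ)

lemma quantileFn_mem_Icc {ν : Measure ℝ} [IsProbabilityMeasure ν] {a b τ : ℝ}
    (h : ν (Set.Icc a b)ᶜ = 0) (hτ : τ ∈ Set.Ioc (0:ℝ) 1) :
    quantileFn ν τ ∈ Set.Icc a b :=
  have hb : b ∈ {z : ℝ | τ ≤ cdf ν z} := hτ.2.trans (one_le_cdf_of_compl_Icc h)
  ⟨le_csInf ⟨b, hb⟩ fun _ hz => le_of_le_cdf h hτ.1 hz,
    csInf_le ⟨a, fun _ hz => le_of_le_cdf h hτ.1 hz⟩ hb⟩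

/-- Shifting the distribution function by `c` shifts the quantile function by at most `c`. -/
lemma quantileFn_le_add {μ ν : Measure ℝ} [IsProbabilityMeasure μ] [IsProbabilityMeasure ν]
    (hμ : HasBoundedSupport μ) (hν : HasBoundedSupport ν) {c : ℝ}
    (h : ∀ z, cdf μ z ≤ cdf ν (z + c)) {τ : ℝ} (hτ : τ ∈ Set.Ioc (0:ℝ) 1) :
    quantileFn ν τ ≤ quantileFn μ τ + c := by
  obtain ⟨a, b, hab⟩ := hμ
  obtain ⟨a', b', hab'⟩ := hν
  rw [← sub_le_iff_le_add]
  refine le_csInf ⟨b, hτ.2.trans (one_le_cdf_of_compl_Icc hab)⟩ fun z hz => ?_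
  rw [sub_le_iff_le_add]
  exact csInf_le ⟨a', fun _ hy => le_of_le_cdf hab' hτ.1 hy⟩ (le_trans hz (h z))

lemma monotoneOn_quantileFn {ν : Measure ℝ} [IsProbabilityMeasure ν]
    (hν : HasBoundedSupport ν) : MonotoneOn (quantileFn ν) (Set.Ioc 0 1) := by
  obtain ⟨a, b, hab⟩ := hν
  intro s hs t ht hst
  exact csInf_le_csInf ⟨a, fun _ hz => le_of_le_cdf hab hs.1 hz⟩
    ⟨b, ht.2.trans (one_le_cdf_of_compl_Icc hab)⟩ fun z hz => le_trans hst hz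

lemma integrableOn_quantileFn {ν : Measure ℝ} [IsProbabilityMeasure ν]
    (hν : HasBoundedSupport ν) : IntegrableOn (quantileFn ν) (Set.Ioc 0 1) := by
  have hm := aemeasurable_restrict_of_monotoneOn (μ := volume) measurableSet_Ioc
    (monotoneOn_quantileFn hν)
  obtain ⟨a, b, hab⟩ := hν
  refine Integrable.of_bound hm.aestronglyMeasurable (max |a| |b|) ?_
  filter_upwards [ae_restrict_mem measurableSet_Ioc] with τ hτ
  have := quantileFn_mem_Icc hab hτ
  exact abs_le_max_abs_abs this.1 this.2

/-- If two quantile functions are uniformly `c`-close, so are their averages over `(s, t]`. -/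
lemma abs_average_quantileFn_sub_le {μ ν : Measure ℝ} [IsProbabilityMeasure μ]
    [IsProbabilityMeasure ν] (hμ : HasBoundedSupport μ) (hν : HasBoundedSupport ν) {c : ℝ}
    (h : ∀ z, cdf μ z ≤ cdf ν (z + c)) (h' : ∀ z, cdf ν z ≤ cdf μ (z + c))
    {s t : ℝ} (hs : 0 ≤ s) (hst : s < t) (ht : t ≤ 1) :
    |(1 / (t - s)) * (∫ τ in s..t, quantileFn μ τ) -
      (1 / (t - s)) * ∫ τ in s..t, quantileFn ν τ| ≤ c := by
  have hsub : Set.Ioc s t ⊆ Set.Ioc 0 1 := Set.Ioc_subset_Ioc hs ht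
  have hint : ∀ {ρ : Measure ℝ} [IsProbabilityMeasure ρ], HasBoundedSupport ρ →
      IntervalIntegrable (quantileFn ρ) volume s t := fun hρ =>
    (intervalIntegrable_iff_integrableOn_Ioc_of_le hst.le).2
      ((integrableOn_quantileFn hρ).mono_set hsub)
  have hpos : 0 < t - s := sub_pos.2 hst
  have hb : ‖∫ τ in s..t, (quantileFn μ τ - quantileFn ν τ)‖ ≤ c * |t - s| := by
    refine intervalIntegral.norm_integral_le_of_norm_le_const fun τ hτ => ?_
    rw [Set.uIoc_of_le hst.le] at hτ
    have h1 := quantileFn_le_add hμ hν h (hsub hτ)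
    have h2 := quantileFn_le_add hν hμ h' (hsub hτ)
    rw [Real.norm_eq_abs, abs_le]
    constructor <;> linarith
  rw [intervalIntegral.integral_sub (hint hμ) (hint hν), Real.norm_eq_abs, abs_of_pos hpos] at hb
  rw [← mul_sub, abs_mul, abs_of_pos (one_div_pos.2 hpos), one_div_mul_eq_div, div_le_iff₀ hpos]
  exact hb

lemma diatomicMeasure_apply (M : MDP X A) (α : ℝ) (π : X → A → ℝ) (Q : X → A → ℝ × ℝ)
    (x : X) (a : A) (s : Set ℝ) :
    diatomicMeasure M α π Q x a s = ∑ x' : X, ∑ a' : A,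
      ENNReal.ofReal (M.P x a x' * π x' a') *
        (ENNReal.ofReal α * Measure.dirac (M.r x a x' + M.γ * (Q x' a').1) s
          + ENNReal.ofReal (1 - α) * Measure.dirac (M.r x a x' + M.γ * (Q x' a').2) s) := by
  simp only [diatomicMeasure, Measure.finsetSum_apply, Measure.smul_apply, Measure.add_apply,
    smul_eq_mul]

lemma isProbabilityMeasure_diatomicMeasure (M : MDP X A) {α : ℝ} (hα : α ∈ Set.Ioo (0:ℝ) 1)
    {π : X → A → ℝ} (hπ : IsPolicy π) (Q : X → A → ℝ × ℝ) (x : X) (a : A) :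
    IsProbabilityMeasure (diatomicMeasure M α π Q x a) := by
  have hnn : ∀ x' a', 0 ≤ M.P x a x' * π x' a' := fun x' a' =>
    mul_nonneg (M.P_nonneg x a x') (hπ.1 x' a')
  have hw : ENNReal.ofReal α + ENNReal.ofReal (1 - α) = 1 := by
    rw [← ENNReal.ofReal_add hα.1.le (sub_nonneg.2 hα.2.le)]
    simp
  constructor
  simp only [diatomicMeasure_apply, measure_univ, mul_one, hw]
  rw [Finset.sum_congr rfl fun x' _ =>
      (ENNReal.ofReal_sum_of_nonneg fun a' _ => hnn x' a').symm,
    ← ENNReal.ofReal_sum_of_nonneg fun x' _ => Finset.sum_nonneg fun a' _ => hnn x' a']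
  simp [← Finset.mul_sum, hπ.2, M.P_sum_one]

lemma hasBoundedSupport_diatomicMeasure (M : MDP X A) (α : ℝ) (π : X → A → ℝ)
    (Q : X → A → ℝ × ℝ) (x : X) (a : A) :
    HasBoundedSupport (diatomicMeasure M α π Q x a) := by
  obtain ⟨B, hB⟩ := Finite.exists_le fun p : X × A =>
    max |M.r x a p.1 + M.γ * (Q p.1 p.2).1| |M.r x a p.1 + M.γ * (Q p.1 p.2).2|
  refine ⟨-B, B, ?_⟩
  rw [diatomicMeasure_apply]
  refine Finset.sum_eq_zero fun x' _ => Finset.sum_eq_zero fun a' _ => ?_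
  have hdirac : ∀ y : ℝ, |y| ≤ B → Measure.dirac y (Set.Icc (-B) B)ᶜ = 0 := fun y hy => by
    simpa [Measure.dirac_apply' _ measurableSet_Icc.compl] using abs_le.1 hy
  have h := max_le_iff.1 (hB (x', a'))
  rw [hdirac _ h.1, hdirac _ h.2]
  simp

lemma cdf_diatomicMeasure_le (M : MDP X A) {α : ℝ} (hα : α ∈ Set.Ioo (0:ℝ) 1)
    {π : X → A → ℝ} (hπ : IsPolicy π) {Q Qt : X → A → ℝ × ℝ} {c : ℝ}
    (h : ∀ x a, (Qt x a).1 ≤ (Q x a).1 + c ∧ (Qt x a).2 ≤ (Q x a).2 + c)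
    (x : X) (a : A) (z : ℝ) :
    cdf (diatomicMeasure M α π Q x a) z ≤ cdf (diatomicMeasure M α π Qt x a) (z + M.γ * c) := by
  have := isProbabilityMeasure_diatomicMeasure M hα hπ Q x a
  have := isProbabilityMeasure_diatomicMeasure M hα hπ Qt x a
  rw [cdf_eq_real, cdf_eq_real]
  refine ENNReal.toReal_mono (measure_ne_top _ _) ?_
  rw [diatomicMeasure_apply, diatomicMeasure_apply]
  have hdirac : ∀ {r u v : ℝ}, v ≤ u + c →
      Measure.dirac (r + M.γ * u) (Set.Iic z) ≤
        Measure.dirac (r + M.γ * v) (Set.Iic (z + M.γ * c)) := fun {r u v} huv => by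
    rw [Measure.dirac_apply' _ measurableSet_Iic, Measure.dirac_apply' _ measurableSet_Iic]
    have := mul_le_mul_of_nonneg_left huv M.γ_nonneg
    by_cases hz : r + M.γ * u ≤ z
    · have hz' : r + M.γ * v ≤ z + M.γ * c := by linarith
      simp [Set.indicator, hz, hz']
    · simp [Set.indicator, hz]
  refine Finset.sum_le_sum fun x' _ => Finset.sum_le_sum fun a' _ => ?_
  exact mul_le_mul_right (add_le_add (mul_le_mul_right (hdirac (h x' a').1) _)
    (mul_le_mul_right (hdirac (h x' a').2) _)) _

theorem stmt6 [Nonempty X] [Nonempty A] (M : MDP X A) (α : ℝ)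
    (hα : α ∈ Set.Ioo (0:ℝ) 1) (π : X → A → ℝ) (hπ : IsPolicy π)
    (Q Qt : X → A → ℝ × ℝ) :
    pairSupNorm (fun x a => ((diatomicT M α π Q x a).1 - (diatomicT M α π Qt x a).1,
                             (diatomicT M α π Q x a).2 - (diatomicT M α π Qt x a).2)) ≤
      M.γ * pairSupNorm (fun x a => ((Q x a).1 - (Qt x a).1, (Q x a).2 - (Qt x a).2)) := by
  set c := pairSupNorm fun x a => ((Q x a).1 - (Qt x a).1, (Q x a).2 - (Qt x a).2) with hc
  have hQ : ∀ x a, |(Q x a).1 - (Qt x a).1| ≤ c ∧ |(Q x a).2 - (Qt x a).2| ≤ c := fun x a =>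
    max_le_iff.1 (le_ciSup (f := fun p : X × A =>
      max |(Q p.1 p.2).1 - (Qt p.1 p.2).1| |(Q p.1 p.2).2 - (Qt p.1 p.2).2|)
      (Set.finite_range _).bddAbove (x, a))
  refine ciSup_le fun ⟨x, a⟩ => ?_
  have := isProbabilityMeasure_diatomicMeasure M hα hπ Q x a
  have := isProbabilityMeasure_diatomicMeasure M hα hπ Qt x a
  have hle := cdf_diatomicMeasure_le M hα hπ (Q := Q) (Qt := Qt) (c := c) (fun x a =>
    ⟨by linarith [(abs_le.1 (hQ x a).1).1], by linarith [(abs_le.1 (hQ x a).2).1]⟩) x a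
  have hle' := cdf_diatomicMeasure_le M hα hπ (Q := Qt) (Qt := Q) (c := c) (fun x a =>
    ⟨by linarith [(abs_le.1 (hQ x a).1).2], by linarith [(abs_le.1 (hQ x a).2).2]⟩) x a
  have hclose := @abs_average_quantileFn_sub_le _ _ _ _
    (hasBoundedSupport_diatomicMeasure M α π Q x a)
    (hasBoundedSupport_diatomicMeasure M α π Qt x a) _ hle hle'
  refine max_le ?_ (hclose hα.1.le hα.2 le_rfl)
  simpa [diatomicT, avarLeft] using hclose le_rfl hα.1 hα.2.le

end
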